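/- In the confusion-matrix OSR setting, suppose the number of close-set samples predicted into a wrong known class, i.e. #{s ∈ S : y s ≠ C+1 ∧ p s ≠ C+1 ∧ p s ≠ y s}, is at least TP_{C+1}(p). Then there exists a prediction map p̃ : S → {1,…,C+1} such that the micro open-set F-score satisfies F(p̃) = F(p) while TP_{C+1}(p̃) = 0, i.e. p̃ classifies every open-set sample into a known class. -/

import Mathlib

open Finset

/-- True positives of class `c`. -/
def TPc {S : Type*} [Fintype S] (y q : S → ℕ) (c : ℕ) : ℕ :=
  (Finset.univ.filter (fun s => y s = c ∧ q s = c)).card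

/-- False positives of class `c`. -/
def FPc {S : Type*} [Fintype S] (y q : S → ℕ) (c : ℕ) : ℕ :=
  (Finset.univ.filter (fun s => y s ≠ c ∧ q s = c)).card

/-- False negatives of class `c`. -/
def FNc {S : Type*} [Fintype S] (y q : S → ℕ) (c : ℕ) : ℕ :=
  (Finset.univ.filter (fun s => y s = c ∧ q s ≠ c)).card

/-- Micro precision over the known classes `1,…,C`. -/
noncomputable def PkMicro {S : Type*} [Fintype S] (y q : S → ℕ) (C : ℕ) : ℝ :=
  ((∑ c ∈ Finset.Icc 1 C, (TPc y q c : ℝ))) /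
    (∑ c ∈ Finset.Icc 1 C, ((TPc y q c : ℝ) + (FPc y q c : ℝ)))

/-- Micro recall (TPR) over the known classes `1,…,C`. -/
noncomputable def TPRkMicro {S : Type*} [Fintype S] (y q : S → ℕ) (C : ℕ) : ℝ :=
  ((∑ c ∈ Finset.Icc 1 C, (TPc y q c : ℝ))) /
    (∑ c ∈ Finset.Icc 1 C, ((TPc y q c : ℝ) + (FNc y q c : ℝ)))

/-- Micro open-set F-score. -/
noncomputable def FMicro {S : Type*} [Fintype S] (y q : S → ℕ) (C : ℕ) : ℝ :=
  2 * (PkMicro y q C * TPRkMicro y q C) / (PkMicro y q C + TPRkMicro y q C)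

theorem tp_add_fp {S : Type*} [Fintype S] (y q : S → ℕ) (c : ℕ) :
    TPc y q c + FPc y q c = (Finset.univ.filter (fun s => q s = c)).card := by
  classical
  unfold TPc FPc
  rw [← Finset.card_union_of_disjoint]
  · congr 1
    ext s
    simp only [Finset.mem_union, Finset.mem_filter, Finset.mem_univ, true_and]
    tauto
  · rw [Finset.disjoint_filter]
    tauto

theorem tp_add_fn {S : Type*} [Fintype S] (y q : S → ℕ) (c : ℕ) :
    TPc y q c + FNc y q c = (Finset.univ.filter (fun s => y s = c)).card := by
  classical
  unfold TPc FNc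
  rw [← Finset.card_union_of_disjoint]
  · congr 1
    ext s
    simp only [Finset.mem_union, Finset.mem_filter, Finset.mem_univ, true_and]
    tauto
  · rw [Finset.disjoint_filter]
    tauto

theorem sum_pred {S : Type*} [Fintype S] (q : S → ℕ) (C : ℕ)
    (hq : ∀ s, q s ∈ Finset.Icc 1 (C + 1)) :
    ∑ c ∈ Finset.Icc 1 C, (Finset.univ.filter (fun s => q s = c)).card
      + (Finset.univ.filter (fun s => q s = C + 1)).card = Fintype.card S := by
  rw [← Finset.sum_Icc_succ_top (by omega), ← Finset.card_univ]
  exact (Finset.card_eq_sum_card_fiberwise (fun s _ => hq s)).symm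

theorem fmicro_congr {S : Type*} [Fintype S] (y p q : S → ℕ) (C : ℕ)
    (hp : ∀ s, p s ∈ Finset.Icc 1 (C + 1))
    (hq : ∀ s, q s ∈ Finset.Icc 1 (C + 1))
    (htp : ∀ c ∈ Finset.Icc 1 C, TPc y q c = TPc y p c)
    (hrej : (Finset.univ.filter (fun s => q s = C + 1)).card
      = (Finset.univ.filter (fun s => p s = C + 1)).card) :
    FMicro y q C = FMicro y p C := by
  have h1 : ∑ c ∈ Finset.Icc 1 C, (TPc y q c : ℝ) = ∑ c ∈ Finset.Icc 1 C, (TPc y p c : ℝ) :=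
    Finset.sum_congr rfl (fun c hc => by rw [htp c hc])
  have h2 : ∑ c ∈ Finset.Icc 1 C, ((TPc y q c : ℝ) + (FNc y q c : ℝ))
      = ∑ c ∈ Finset.Icc 1 C, ((TPc y p c : ℝ) + (FNc y p c : ℝ)) :=
    Finset.sum_congr rfl (fun c _ => by
      exact_mod_cast (tp_add_fn y q c).trans (tp_add_fn y p c).symm)
  have h3 : ∑ c ∈ Finset.Icc 1 C, ((TPc y q c : ℝ) + (FPc y q c : ℝ))
      = ∑ c ∈ Finset.Icc 1 C, ((TPc y p c : ℝ) + (FPc y p c : ℝ)) := by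
    have : ∑ c ∈ Finset.Icc 1 C, (TPc y q c + FPc y q c)
        = ∑ c ∈ Finset.Icc 1 C, (TPc y p c + FPc y p c) := by
      simp only [tp_add_fp]
      have := sum_pred q C hq
      have := sum_pred p C hp
      omega
    exact_mod_cast this
  unfold FMicro PkMicro TPRkMicro
  rw [h1, h2, h3]

/-- Inconsistency Property I for the micro open-set F-score. -/
theorem inconsistency_property_I_micro_fscore
    {S : Type*} [Fintype S] [Nonempty S] (C : ℕ) (hC : 1 ≤ C)
    (y p : S → ℕ)
    (hy : ∀ s, y s ∈ Finset.Icc 1 (C + 1))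
    (hp : ∀ s, p s ∈ Finset.Icc 1 (C + 1))
    (hcond : TPc y p (C + 1) ≤
      (Finset.univ.filter (fun s => y s ≠ C + 1 ∧ p s ≠ C + 1 ∧ p s ≠ y s)).card) :
    ∃ pt : S → ℕ,
      (∀ s, pt s ∈ Finset.Icc 1 (C + 1)) ∧
      FMicro y pt C = FMicro y p C ∧
      TPc y pt (C + 1) = 0 := by
  classical
  obtain ⟨T, hTW, hT⟩ := Finset.exists_subset_card_eq hcond
  have hT' : ∀ s ∈ T, y s ≠ C + 1 ∧ p s ≠ C + 1 ∧ p s ≠ y s := fun s hs => by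
    simpa using hTW hs
  let pt : S → ℕ := fun s =>
    if s ∈ T then C + 1 else if y s = C + 1 ∧ p s = C + 1 then 1 else p s
  have hpt : ∀ s, pt s = if s ∈ T then C + 1 else
    if y s = C + 1 ∧ p s = C + 1 then 1 else p s := fun s => rfl
  have hmem : ∀ s, pt s ∈ Finset.Icc 1 (C + 1) := by
    intro s
    have := hp s
    rw [hpt]
    simp only [Finset.mem_Icc] at *
    split_ifs <;> omega
  refine ⟨pt, hmem, ?_, ?_⟩
  · apply fmicro_congr y p pt C hp hmem
    · intro c hc
      unfold TPc
      congr 1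
      ext s
      simp only [Finset.mem_filter, Finset.mem_univ, true_and, Finset.mem_Icc] at *
      have := hT' s
      rw [hpt]
      split_ifs with h1 h2
      · have := hT' s h1
        omega
      · omega
      · rfl
    · have e1 : Finset.univ.filter (fun s => pt s = C + 1)
          = T ∪ Finset.univ.filter (fun s => y s ≠ C + 1 ∧ p s = C + 1) := by
        ext s
        simp only [Finset.mem_union, Finset.mem_filter, Finset.mem_univ, true_and]
        rw [hpt]
        split_ifs with h1 h2
        · simp [h1]
        · simp only [h1, false_or]
          omega
        · simp only [h1, false_or]
          tauto
      rw [e1, Finset.card_union_of_disjoint, hT, ← tp_add_fp y p (C + 1)]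
      · rfl
      · rw [Finset.disjoint_left]
        intro s hs h
        have := hT' s hs
        simp only [Finset.mem_filter, Finset.mem_univ, true_and] at h
        omega
  · unfold TPc
    rw [Finset.card_eq_zero, Finset.filter_eq_empty_iff]
    rintro s - ⟨h1, h2⟩
    rw [hpt] at h2
    split_ifs at h2 with h3 h4
    · exact (hT' s h3).1 h1
    · omega
    · exact h4 ⟨h1, h2⟩
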